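/- There exists a function g : ℝ → ℝ of class C² solving g″(t) = W′(g(t)) for all t ∈ ℝ, with −1 < g < 1, g(0) = 0 and lim_{t→+∞} g(t) = 1, lim_{t→−∞} g(t) = −1; this solution is unique; and it satisfies the first-integral identity g′(t) = √(2 W(g(t))) > 0 for every t ∈ ℝ (in particular g is strictly increasing). -/

import Mathlib

open Set Metric MeasureTheory Filter
open scoped RealInnerProductSpace

noncomputable section

/-- Euclidean space `ℝⁿ`. -/
abbrev Euc (n : ℕ) : Type := EuclideanSpace ℝ (Fin n)

/-- Standard orthonormal basis vector of `ℝⁿ`. -/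
def eb (n : ℕ) (i : Fin n) : Euc n := EuclideanSpace.basisFun (Fin n) ℝ i

/-- Laplacian, as the trace of the second derivative along the standard orthonormal basis. -/
def lap {n : ℕ} (f : Euc n → ℝ) (x : Euc n) : ℝ :=
  ∑ i : Fin n, iteratedFDeriv ℝ 2 f x ![eb n i, eb n i]

/-- Divergence of a vector field. -/
def divg {n : ℕ} (F : Euc n → Euc n) (x : Euc n) : ℝ :=
  ∑ i : Fin n, ⟪fderiv ℝ F x (eb n i), eb n i⟫

/-- Squared Frobenius norm of the Hessian. -/
def hessSq {n : ℕ} (f : Euc n → ℝ) (x : Euc n) : ℝ :=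
  ∑ i : Fin n, ∑ j : Fin n, (iteratedFDeriv ℝ 2 f x ![eb n i, eb n j]) ^ 2

open Classical in
/-- `|B(u)(x)|`, with value `0` where the gradient vanishes. -/
def Bnorm {n : ℕ} (u : Euc n → ℝ) (x : Euc n) : ℝ :=
  if gradient u x = 0 then 0
  else Real.sqrt ((hessSq u x - ‖gradient (fun y => ‖gradient u y‖) x‖ ^ 2) /
    ‖gradient u x‖ ^ 2)

/-- Mean curvature of level sets: `div(∇u/|∇u|)`. -/
def meanCurv {n : ℕ} (u : Euc n → ℝ) (x : Euc n) : ℝ :=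
  divg (fun y => ‖gradient u y‖⁻¹ • gradient u y) x

/-- Orthogonal projection onto the tangent space of the level set of `u` through `x`. -/
def tproj {n : ℕ} (u : Euc n → ℝ) (x X : Euc n) : Euc n :=
  X - (⟪gradient u x, X⟫ / ‖gradient u x‖ ^ 2) • gradient u x

/-- Second fundamental form of the level set of `u` through `x`, extended to all of `ℝⁿ`
via the tangential projection. -/
def sff {n : ℕ} (u : Euc n → ℝ) (x X Y : Euc n) : ℝ :=
  iteratedFDeriv ℝ 2 u x ![tproj u x X, tproj u x Y] / ‖gradient u x‖

/-- `W` is a double-well potential. -/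
def IsDoubleWell (W : ℝ → ℝ) : Prop :=
  ContDiffOn ℝ 3 W (Icc (-1) 1) ∧ (∀ t ∈ Ioo (-1:ℝ) 1, 0 < W t) ∧
  W (-1) = 0 ∧ W 1 = 0 ∧ deriv W (-1) = 0 ∧ deriv W 1 = 0 ∧
  iteratedDeriv 2 W (-1) = 1 ∧ iteratedDeriv 2 W 1 = 1 ∧
  deriv W 0 = 0 ∧ ∀ t ∈ Ioo (-1:ℝ) 1, deriv W t = 0 → t = 0

/-- `u` is a classical solution of the singularly perturbed Allen–Cahn equation
`ε Δu = ε⁻¹ W′(u)`, `|u| < 1`, on `Ω`. -/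
def ACSolution {n : ℕ} (W : ℝ → ℝ) (ε : ℝ) (u : Euc n → ℝ) (Ω : Set (Euc n)) : Prop :=
  ContDiffOn ℝ 2 u Ω ∧ (∀ x ∈ Ω, u x ∈ Ioo (-1:ℝ) 1) ∧
  ∀ x ∈ Ω, ε * lap u x = ε⁻¹ * deriv W (u x)

/-- Stability: `∫_Ω ε²|∇η|² + W″(u)η² ≥ 0` for all smooth `η` compactly supported in `Ω`. -/
def StableAC {n : ℕ} (W : ℝ → ℝ) (ε : ℝ) (u : Euc n → ℝ) (Ω : Set (Euc n)) : Prop :=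
  ∀ η : Euc n → ℝ, ContDiff ℝ (⊤ : ℕ∞) η → HasCompactSupport η → tsupport η ⊆ Ω →
    0 ≤ ∫ x in Ω, (ε ^ 2 * ‖gradient η x‖ ^ 2 + iteratedDeriv 2 W (u x) * (η x) ^ 2)

/-- `∇u ≠ 0` and `|B(u)| ≤ Λ` on `{|u| ≤ 1−b} ∩ Ω`. -/
def CurvBound {n : ℕ} (u : Euc n → ℝ) (b Λ : ℝ) (Ω : Set (Euc n)) : Prop :=
  ∀ x ∈ Ω, |u x| ≤ 1 - b → gradient u x ≠ 0 ∧ Bnorm u x ≤ Λ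

/-- The part of the zero set `{u = 0}` away from the connected component of `x`. -/
def compSet {n : ℕ} (u : Euc n → ℝ) (x : Euc n) : Set (Euc n) :=
  {y | u y = 0} \ connectedComponentIn {y | u y = 0} x

/-- `A(r) = sup { e^{−D(x)} : x ∈ {u = 0} ∩ closure(B_r(0)) }`, where
`D(x) = dist(x, {u=0} ∖ Γ_x)` and points with `{u=0} ∖ Γ_x = ∅` contribute `0`. -/
def Afun {n : ℕ} (u : Euc n → ℝ) (r : ℝ) : ℝ :=
  sSup {t : ℝ | ∃ x : Euc n, u x = 0 ∧ x ∈ closedBall 0 r ∧ (compSet u x).Nonempty ∧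
    t = Real.exp (-Metric.infDist x (compSet u x))}

/-- The rescaled stable Allen–Cahn setting: `Δu = W′(u)` on `B_{1/ε}(0)`, stable, with
`∇u ≠ 0` and `|B(u)| ≤ Λε` on `{|u| ≤ 1−b}`. -/
def RescaledSetting {n : ℕ} (W : ℝ → ℝ) (b Λ ε : ℝ) (u : Euc n → ℝ) : Prop :=
  ACSolution W 1 u (ball 0 (1/ε)) ∧ StableAC W 1 u (ball 0 (1/ε)) ∧
  CurvBound u b (Λ * ε) (ball 0 (1/ε))


section DoubleWellEstimates

variable {W : ℝ → ℝ}

lemma derivWithin_Icc_eq_zero_of_deriv {a : ℝ} (hW : ContDiffOn ℝ 3 W (Icc (-1) 1))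
    (ha : a ∈ Icc (-1:ℝ) 1) (h1 : deriv W a = 0) (h2 : iteratedDeriv 2 W a = 1) :
    derivWithin W (Icc (-1) 1) a = 0 := by
  have hd : DifferentiableAt ℝ (deriv W) a := by
    apply differentiableAt_of_deriv_ne_zero
    rw [iteratedDeriv_succ, iteratedDeriv_one] at h2
    rw [h2]; exact one_ne_zero
  have hcl : a ∈ closure (Ioo (-1:ℝ) 1) := by
    rwa [closure_Ioo (by norm_num)]
  have : (nhdsWithin a (Ioo (-1:ℝ) 1)).NeBot := mem_closure_iff_nhdsWithin_neBot.1 hcl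
  have l1 : Tendsto (deriv W) (nhdsWithin a (Ioo (-1:ℝ) 1)) (nhds 0) := by
    rw [← h1]; exact hd.continuousAt.tendsto.mono_left nhdsWithin_le_nhds
  have hc := hW.continuousOn_derivWithin (uniqueDiffOn_Icc (by norm_num)) (by norm_num) a ha
  have l2 := hc.tendsto.mono_left (nhdsWithin_mono a Ioo_subset_Icc_self)
  refine tendsto_nhds_unique l2 (l1.congr' ?_)
  filter_upwards [self_mem_nhdsWithin] with x hx
  exact (derivWithin_of_mem_nhds (Icc_mem_nhds hx.1 hx.2)).symm

lemma exists_abs_le_mul_sq_of_derivWithin_eq_zero {a : ℝ}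
    (hW : ContDiffOn ℝ 3 W (Icc (-1) 1)) (ha : a ∈ Icc (-1:ℝ) 1) (h0 : W a = 0)
    (h1 : derivWithin W (Icc (-1) 1) a = 0) :
    ∃ M : ℝ, 0 ≤ M ∧ ∀ s ∈ Icc (-1:ℝ) 1, |W s| ≤ M * (s - a) ^ 2 := by
  have hu : UniqueDiffOn ℝ (Icc (-1:ℝ) 1) := uniqueDiffOn_Icc (by norm_num)
  have hw : ContDiffOn ℝ 2 (derivWithin W (Icc (-1) 1)) (Icc (-1) 1) :=
    hW.derivWithin hu (by norm_num)
  obtain ⟨K, hK⟩ := hw.exists_lipschitzOnWith (by norm_num) (convex_Icc _ _) isCompact_Icc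
  refine ⟨K, K.2, fun s hs => ?_⟩
  have hsub : uIcc a s ⊆ Icc (-1:ℝ) 1 := ordConnected_Icc.uIcc_subset ha hs
  have hb : ∀ x ∈ uIcc a s, ‖derivWithin W (Icc (-1) 1) x‖ ≤ K * |s - a| := by
    intro x hx
    have := hK.dist_le_mul x (hsub hx) a ha
    rw [h1, dist_zero_right, Real.dist_eq] at this
    exact this.trans (mul_le_mul_of_nonneg_left (abs_sub_left_of_mem_uIcc hx) K.2)
  have hder : ∀ x ∈ uIcc a s,
      HasDerivWithinAt W (derivWithin W (Icc (-1) 1) x) (uIcc a s) x := fun x hx =>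
    ((hW.differentiableOn (by norm_num)) x (hsub hx)).hasDerivWithinAt.mono hsub
  have := (convex_uIcc a s).norm_image_sub_le_of_norm_hasDerivWithin_le hder hb
    left_mem_uIcc right_mem_uIcc
  rw [h0, sub_zero, Real.norm_eq_abs, Real.norm_eq_abs, mul_assoc, ← sq, sq_abs] at this
  exact this

lemma IsDoubleWell.exists_le_mul_sq (hW : IsDoubleWell W) :
    ∃ C : ℝ, 0 < C ∧ ∀ s ∈ Ioo (-1:ℝ) 1, W s ≤ C * (1 - s ^ 2) ^ 2 := by
  obtain ⟨hc, -, hm, hp, hm1, hp1, hm2, hp2, -, -⟩ := hW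
  obtain ⟨A, hA, hA'⟩ := exists_abs_le_mul_sq_of_derivWithin_eq_zero hc (by norm_num) hm
    (derivWithin_Icc_eq_zero_of_deriv hc (by norm_num) hm1 hm2)
  obtain ⟨B, hB, hB'⟩ := exists_abs_le_mul_sq_of_derivWithin_eq_zero hc (by norm_num) hp
    (derivWithin_Icc_eq_zero_of_deriv hc (by norm_num) hp1 hp2)
  refine ⟨A + B + 1, by positivity, fun s hs => ?_⟩
  have hs' := Ioo_subset_Icc_self hs
  obtain ⟨h1, h2⟩ := hs
  have e1 := (le_abs_self _).trans (hA' s hs')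
  have e2 := (le_abs_self _).trans (hB' s hs')
  rcases le_total 0 s with h | h
  · have : (s - 1) ^ 2 ≤ (1 - s ^ 2) ^ 2 := by
      rw [← neg_sq (s - 1)]
      exact pow_le_pow_left₀ (by linarith) (by nlinarith) 2
    nlinarith [sq_nonneg (1 - s ^ 2)]
  · have : (s - -1) ^ 2 ≤ (1 - s ^ 2) ^ 2 :=
      pow_le_pow_left₀ (by linarith) (by nlinarith) 2
    nlinarith [sq_nonneg (1 - s ^ 2)]

lemma IsDoubleWell.contDiffAt (hW : IsDoubleWell W) {s : ℝ} (hs : s ∈ Ioo (-1:ℝ) 1) :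
    ContDiffAt ℝ 3 W s :=
  hW.1.contDiffAt (Icc_mem_nhds hs.1 hs.2)

lemma IsDoubleWell.hasDerivAt (hW : IsDoubleWell W) {s : ℝ} (hs : s ∈ Ioo (-1:ℝ) 1) :
    HasDerivAt W (deriv W s) s :=
  ((hW.contDiffAt hs).differentiableAt (by norm_num)).hasDerivAt

lemma IsDoubleWell.continuousOn (hW : IsDoubleWell W) : ContinuousOn W (Ioo (-1) 1) :=
  hW.1.continuousOn.mono Ioo_subset_Icc_self

lemma IsDoubleWell.sqrt_two_mul_pos (hW : IsDoubleWell W) {s : ℝ} (hs : s ∈ Ioo (-1:ℝ) 1) :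
    0 < Real.sqrt (2 * W s) :=
  Real.sqrt_pos.2 (mul_pos two_pos (hW.2.1 s hs))

end DoubleWellEstimates

section HyperbolicTangent

lemma hasDerivAt_tanh (x : ℝ) : HasDerivAt Real.tanh (1 - Real.tanh x ^ 2) x := by
  have hc := (Real.cosh_pos x).ne'
  have h := (Real.hasDerivAt_sinh x).div (Real.hasDerivAt_cosh x) hc
  have e : Real.tanh = fun y => Real.sinh y / Real.cosh y := funext Real.tanh_eq_sinh_div_cosh
  rw [Real.tanh_eq_sinh_div_cosh, e]
  refine h.congr_deriv ?_
  field_simp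

lemma continuous_tanh : Continuous Real.tanh :=
  continuous_iff_continuousAt.2 fun x => (hasDerivAt_tanh x).continuousAt

lemma tanh_mem_Ioo (x : ℝ) : Real.tanh x ∈ Ioo (-1:ℝ) 1 :=
  ⟨Real.neg_one_lt_tanh x, Real.tanh_lt_one x⟩

lemma one_sub_sq_pos_of_mem_Ioo {s : ℝ} (hs : s ∈ Ioo (-1:ℝ) 1) : 0 < 1 - s ^ 2 := by
  nlinarith [hs.1, hs.2]

lemma hasDerivAt_artanh {s : ℝ} (hs : s ∈ Ioo (-1:ℝ) 1) :
    HasDerivAt Real.artanh (1 - s ^ 2)⁻¹ s := by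
  have h1 : 0 < 1 + s := by linarith [hs.1]
  have h2 : 0 < 1 - s := by linarith [hs.2]
  have hq : HasDerivAt (fun x : ℝ => (1 + x) / (1 - x))
      ((1 * (1 - s) - (1 + s) * (-1)) / (1 - s) ^ 2) s :=
    ((hasDerivAt_id s).const_add 1).div ((hasDerivAt_id s).const_sub 1) h2.ne'
  have h := (hq.log (div_pos h1 h2).ne').const_mul (1 / 2 : ℝ)
  have e : Real.artanh =ᶠ[nhds s] fun x => 1 / 2 * Real.log ((1 + x) / (1 - x)) := by
    filter_upwards [Icc_mem_nhds hs.1 hs.2] with x hx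
    exact Real.artanh_eq_half_log hx
  refine (h.congr_of_eventuallyEq e).congr_deriv ?_
  rw [show 1 - s ^ 2 = (1 + s) * (1 - s) by ring]
  field_simp
  ring

lemma tanh_strictMono : StrictMono Real.tanh :=
  strictMono_of_deriv_pos fun x => by
    rw [(hasDerivAt_tanh x).deriv]
    exact one_sub_sq_pos_of_mem_Ioo (tanh_mem_Ioo x)

lemma tendsto_tanh_atTop : Tendsto Real.tanh atTop (nhds 1) := by
  refine tendsto_order.2 ⟨fun a ha => ?_, fun a ha => ?_⟩
  · have hm : max a 0 ∈ Ioo (-1:ℝ) 1 :=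
      ⟨neg_one_lt_zero.trans_le (le_max_right a 0), max_lt ha one_pos⟩
    filter_upwards [eventually_gt_atTop (Real.artanh (max a 0))] with x hx
    have := tanh_strictMono hx
    rw [Real.tanh_artanh hm] at this
    exact (le_max_left a 0).trans_lt this
  · exact Eventually.of_forall fun x => (Real.tanh_lt_one x).trans ha

lemma tendsto_tanh_atBot : Tendsto Real.tanh atBot (nhds (-1)) := by
  have h := (tendsto_tanh_atTop.comp tendsto_neg_atBot_atTop).neg
  refine h.congr fun x => ?_
  simp [Real.tanh_neg]

end HyperbolicTangent

section Heteroclinic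

variable {W : ℝ → ℝ}

/-- In the coordinate `x = artanh s`, the density `ds / √(2 W(s))` of the travel time along a
heteroclinic profile. -/
def timeDensity (W : ℝ → ℝ) (x : ℝ) : ℝ :=
  (1 - Real.tanh x ^ 2) / Real.sqrt (2 * W (Real.tanh x))

/-- The time a heteroclinic profile started at `0` needs to reach the height `tanh x`. -/
def travelTime (W : ℝ → ℝ) (x : ℝ) : ℝ := ∫ y in (0:ℝ)..x, timeDensity W y

lemma IsDoubleWell.continuous_timeDensity (hW : IsDoubleWell W) : Continuous (timeDensity W) := by
  have h : Continuous fun x => W (Real.tanh x) :=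
    hW.continuousOn.comp_continuous continuous_tanh tanh_mem_Ioo
  exact (continuous_const.sub (continuous_tanh.pow 2)).div (continuous_const.mul h).sqrt
    fun x => (hW.sqrt_two_mul_pos (tanh_mem_Ioo x)).ne'

lemma IsDoubleWell.timeDensity_pos (hW : IsDoubleWell W) (x : ℝ) : 0 < timeDensity W x :=
  div_pos (one_sub_sq_pos_of_mem_Ioo (tanh_mem_Ioo x)) (hW.sqrt_two_mul_pos (tanh_mem_Ioo x))

lemma IsDoubleWell.exists_le_timeDensity (hW : IsDoubleWell W) :
    ∃ c : ℝ, 0 < c ∧ ∀ x, c ≤ timeDensity W x := by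
  obtain ⟨C, hC, hb⟩ := hW.exists_le_mul_sq
  refine ⟨(Real.sqrt (2 * C))⁻¹, by positivity, fun x => ?_⟩
  have hp := one_sub_sq_pos_of_mem_Ioo (tanh_mem_Ioo x)
  have hs := hW.sqrt_two_mul_pos (tanh_mem_Ioo x)
  have hC' : 0 < Real.sqrt (2 * C) := by positivity
  have key : Real.sqrt (2 * W (Real.tanh x)) ≤ Real.sqrt (2 * C) * (1 - Real.tanh x ^ 2) := by
    rw [← Real.sqrt_sq hp.le, ← Real.sqrt_mul (by positivity)]
    apply Real.sqrt_le_sqrt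
    linarith [hb _ (tanh_mem_Ioo x)]
  rw [timeDensity, le_div_iff₀ hs, inv_mul_le_iff₀ hC']
  exact key

lemma IsDoubleWell.hasDerivAt_travelTime (hW : IsDoubleWell W) (x : ℝ) :
    HasDerivAt (travelTime W) (timeDensity W x) x :=
  hW.continuous_timeDensity.integral_hasStrictDerivAt 0 x |>.hasDerivAt

lemma IsDoubleWell.travelTime_strictMono (hW : IsDoubleWell W) : StrictMono (travelTime W) :=
  strictMono_of_deriv_pos fun x => by
    rw [(hW.hasDerivAt_travelTime x).deriv]
    exact hW.timeDensity_pos x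

lemma travelTime_zero : travelTime W 0 = 0 := intervalIntegral.integral_same

lemma IsDoubleWell.travelTime_surjective (hW : IsDoubleWell W) :
    Function.Surjective (travelTime W) := by
  obtain ⟨c, hc, hb⟩ := hW.exists_le_timeDensity
  have hd : ∀ x, HasDerivAt (fun x => travelTime W x - c * x) (timeDensity W x - c) x := fun x =>
    ((hW.hasDerivAt_travelTime x).sub ((hasDerivAt_id x).const_mul c)).congr_deriv (by simp)
  have hm : Monotone fun x => travelTime W x - c * x :=
    monotone_of_deriv_nonneg (fun x => (hd x).differentiableAt) fun x => by
      rw [(hd x).deriv]; exact sub_nonneg.2 (hb x)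
  have hcont : Continuous (travelTime W) :=
    continuous_iff_continuousAt.2 fun x => (hW.hasDerivAt_travelTime x).continuousAt
  refine hcont.surjective ?_ ?_
  · refine tendsto_atTop_mono' _ ?_ (tendsto_id.const_mul_atTop hc)
    filter_upwards [eventually_ge_atTop 0] with x hx
    have := hm hx
    simp only [travelTime_zero, id] at this ⊢
    linarith
  · refine tendsto_atBot_mono' _ ?_ (tendsto_id.const_mul_atBot hc)
    filter_upwards [eventually_le_atBot 0] with x hx
    have := hm hx
    simp only [travelTime_zero, id] at this ⊢
    linarith

lemma hasDerivAt_travelTime_artanh (hW : IsDoubleWell W) {h : ℝ → ℝ} {t : ℝ}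
    (hmem : h t ∈ Ioo (-1:ℝ) 1) (hd : HasDerivAt h (Real.sqrt (2 * W (h t))) t) :
    HasDerivAt (fun t => travelTime W (Real.artanh (h t))) 1 t := by
  refine ((hW.hasDerivAt_travelTime (Real.artanh (h t))).comp t
    ((hasDerivAt_artanh hmem).comp t hd)).congr_deriv ?_
  have hp := (one_sub_sq_pos_of_mem_Ioo hmem).ne'
  have hs := (hW.sqrt_two_mul_pos hmem).ne'
  rw [timeDensity, Real.tanh_artanh hmem]
  field_simp

/-- A solution of the first-order equation is determined by its value at `0`. -/
lemma travelTime_artanh_eq (hW : IsDoubleWell W) {h : ℝ → ℝ}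
    (hmem : ∀ t, h t ∈ Ioo (-1:ℝ) 1) (h0 : h 0 = 0)
    (hd : ∀ t, HasDerivAt h (Real.sqrt (2 * W (h t))) t) (t : ℝ) :
    travelTime W (Real.artanh (h t)) = t := by
  have hd' : ∀ t, HasDerivAt (fun t => travelTime W (Real.artanh (h t)) - t) 0 t := fun t =>
    ((hasDerivAt_travelTime_artanh hW (hmem t) (hd t)).sub (hasDerivAt_id t)).congr_deriv (by simp)
  have := is_const_of_deriv_eq_zero (fun t => (hd' t).differentiableAt)
    (fun t => (hd' t).deriv) t 0
  simp only [h0, Real.artanh_zero, travelTime_zero, sub_zero] at this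
  linarith

lemma IsDoubleWell.hasDerivAt_sqrt_comp (hW : IsDoubleWell W) {h : ℝ → ℝ} {t : ℝ}
    (hmem : h t ∈ Ioo (-1:ℝ) 1) (hd : HasDerivAt h (Real.sqrt (2 * W (h t))) t) :
    HasDerivAt (fun t => Real.sqrt (2 * W (h t))) (deriv W (h t)) t := by
  have hs := hW.sqrt_two_mul_pos hmem
  have h1 := (((hW.hasDerivAt hmem).comp t hd).const_mul 2).sqrt
    (mul_pos two_pos (hW.2.1 _ hmem)).ne'
  refine h1.congr_deriv ?_
  simp only [Function.comp]
  field_simp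

/-- Solutions of the first-order equation are `C²`. -/
lemma IsDoubleWell.contDiff_two (hW : IsDoubleWell W) {h : ℝ → ℝ}
    (hmem : ∀ t, h t ∈ Ioo (-1:ℝ) 1) (hd : ∀ t, HasDerivAt h (Real.sqrt (2 * W (h t))) t) :
    ContDiff ℝ 2 h := by
  have hh : Differentiable ℝ h := fun t => (hd t).differentiableAt
  have hcont : Continuous fun t => deriv W (h t) := by
    exact ((hW.1.mono Ioo_subset_Icc_self).continuousOn_deriv_of_isOpen isOpen_Ioo
      (by norm_num)).comp_continuous hh.continuous hmem
  have h1 : deriv h = fun t => Real.sqrt (2 * W (h t)) := funext fun t => (hd t).deriv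
  have hd2 := fun t => hW.hasDerivAt_sqrt_comp (hmem t) (hd t)
  rw [show (2 : WithTop ℕ∞) = 1 + 1 by norm_num, contDiff_succ_iff_deriv]
  refine ⟨hh, by simp, ?_⟩
  rw [h1, contDiff_one_iff_deriv]
  refine ⟨fun t => (hd2 t).differentiableAt, ?_⟩
  rwa [show deriv (fun t => Real.sqrt (2 * W (h t))) = fun t => deriv W (h t) from
    funext fun t => (hd2 t).deriv]

lemma IsDoubleWell.exists_profile (hW : IsDoubleWell W) :
    ∃ g : ℝ → ℝ, (∀ t, g t ∈ Ioo (-1:ℝ) 1) ∧ g 0 = 0 ∧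
      Tendsto g atTop (nhds 1) ∧ Tendsto g atBot (nhds (-1)) ∧
      ∀ t, HasDerivAt g (Real.sqrt (2 * W (g t))) t := by
  let e := hW.travelTime_strictMono.orderIsoOfSurjective _ hW.travelTime_surjective
  have he : ∀ t, travelTime W (e.symm t) = t := e.apply_symm_apply
  refine ⟨fun t => Real.tanh (e.symm t), fun t => tanh_mem_Ioo _, ?_,
    tendsto_tanh_atTop.comp e.symm.tendsto_atTop, tendsto_tanh_atBot.comp e.symm.tendsto_atBot,
    fun t => ?_⟩
  · have : e.symm 0 = 0 := e.symm_apply_eq.2 (travelTime_zero (W := W)).symm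
    simp [this]
  · have hi : HasDerivAt e.symm (timeDensity W (e.symm t))⁻¹ t :=
      (hW.hasDerivAt_travelTime _).of_local_left_inverse e.symm.continuous.continuousAt
        (hW.timeDensity_pos _).ne' (Eventually.of_forall he)
    refine ((hasDerivAt_tanh _).comp t hi).congr_deriv ?_
    have hp := (one_sub_sq_pos_of_mem_Ioo (tanh_mem_Ioo (e.symm t))).ne'
    rw [timeDensity, inv_div]
    field_simp

/-- The first integral: a solution of `h″ = W′(h)` joining `-1` to `1` has zero energy. -/
lemma IsDoubleWell.hasDerivAt_of_heteroclinic (hW : IsDoubleWell W) {h : ℝ → ℝ}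
    (hC : ContDiff ℝ 2 h) (hode : ∀ t, deriv (deriv h) t = deriv W (h t))
    (hmem : ∀ t, h t ∈ Ioo (-1:ℝ) 1) (htop : Tendsto h atTop (nhds 1))
    (hbot : Tendsto h atBot (nhds (-1))) (t : ℝ) :
    HasDerivAt h (Real.sqrt (2 * W (h t))) t := by
  have hh : Differentiable ℝ h := hC.differentiable (by norm_num)
  have hC1 : ContDiff ℝ 1 (deriv h) :=
    (contDiff_succ_iff_deriv.1 (show ContDiff ℝ (1 + 1) h by norm_num; exact hC)).2.2
  have hd2 : ∀ t, HasDerivAt (deriv h) (deriv W (h t)) t := fun t => by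
    rw [← hode t]; exact (hC1.differentiable (by norm_num) t).hasDerivAt
  have hE : ∀ t, HasDerivAt (fun t => deriv h t ^ 2 - 2 * W (h t)) 0 t := fun t => by
    refine (((hd2 t).pow 2).sub
      (((hW.hasDerivAt (hmem t)).comp t (hh t).hasDerivAt).const_mul 2)).congr_deriv ?_
    push_cast
    ring
  obtain ⟨E, hEc⟩ : ∃ E, ∀ t, deriv h t ^ 2 - 2 * W (h t) = E :=
    ⟨_, fun t => is_const_of_deriv_eq_zero (fun t => (hE t).differentiableAt)
      (fun t => (hE t).deriv) t 0⟩
  have hWlim : Tendsto (fun t => W (h t)) atTop (nhds 0) := by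
    have h1 := (hW.1.continuousOn 1 (by norm_num)).tendsto
    rw [hW.2.2.2.1] at h1
    exact h1.comp (tendsto_nhdsWithin_iff.2
      ⟨htop, Eventually.of_forall fun t => Ioo_subset_Icc_self (hmem t)⟩)
  have hE0 : 0 ≤ E := by
    have hl : Tendsto (fun t => -(2 * W (h t))) atTop (nhds 0) := by
      simpa using (hWlim.const_mul 2).neg
    exact le_of_tendsto hl (Eventually.of_forall fun t => by
      linarith [hEc t, sq_nonneg (deriv h t)])
  have hE1 : E ≤ 0 := by
    have hl : Tendsto (fun t => (h (t + 1) - h t) ^ 2) atTop (nhds 0) := by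
      simpa using
        ((htop.comp (tendsto_atTop_add_const_right _ (1:ℝ) tendsto_id)).sub htop).pow 2
    refine ge_of_tendsto hl (Eventually.of_forall fun t => ?_)
    obtain ⟨c, -, hc⟩ := exists_deriv_eq_slope h (lt_add_one t) hh.continuous.continuousOn
      hh.differentiableOn
    rw [add_sub_cancel_left, div_one] at hc
    rw [← hc]
    linarith [hEc c, hW.2.1 _ (hmem c)]
  have hsq : ∀ t, deriv h t ^ 2 = 2 * W (h t) := fun t => by linarith [hEc t]
  have hne : ∀ t, deriv h t ≠ 0 := fun t h0 => by
    have := hsq t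
    rw [h0] at this
    linarith [hW.2.1 _ (hmem t)]
  obtain ⟨c, hc⟩ : ∃ c, 0 < deriv h c := by
    obtain ⟨a, ha0, ha⟩ :=
      ((eventually_lt_atBot (0:ℝ)).and (hbot.eventually (gt_mem_nhds neg_one_lt_zero))).exists
    obtain ⟨b, hb0, hb⟩ :=
      ((eventually_gt_atTop (0:ℝ)).and (htop.eventually (lt_mem_nhds one_pos))).exists
    obtain ⟨c, -, hc⟩ := exists_deriv_eq_slope h (ha0.trans hb0) hh.continuous.continuousOn
      hh.differentiableOn
    exact ⟨c, hc ▸ div_pos (by linarith) (by linarith)⟩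
  have hpos : 0 < deriv h t := by
    by_contra hn
    obtain ⟨s, hs⟩ := mem_range_of_exists_le_of_exists_ge hC1.continuous
      ⟨t, not_lt.1 hn⟩ ⟨c, hc.le⟩
    exact hne s hs
  rw [← hsq t, Real.sqrt_sq hpos.le]
  exact (hh t).hasDerivAt

end Heteroclinic

/-- Existence, uniqueness and the first-integral identity for the one-dimensional
heteroclinic profile. -/
theorem stmt19 (W : ℝ → ℝ) (hW : IsDoubleWell W) :
    ∃ g : ℝ → ℝ,
      (ContDiff ℝ 2 g ∧ (∀ t, deriv (deriv g) t = deriv W (g t)) ∧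
        (∀ t, g t ∈ Ioo (-1:ℝ) 1) ∧ g 0 = 0 ∧
        Tendsto g atTop (nhds 1) ∧ Tendsto g atBot (nhds (-1))) ∧
      (∀ h : ℝ → ℝ,
        (ContDiff ℝ 2 h ∧ (∀ t, deriv (deriv h) t = deriv W (h t)) ∧
          (∀ t, h t ∈ Ioo (-1:ℝ) 1) ∧ h 0 = 0 ∧
          Tendsto h atTop (nhds 1) ∧ Tendsto h atBot (nhds (-1))) → h = g) ∧
      (∀ t : ℝ, deriv g t = Real.sqrt (2 * W (g t)) ∧ 0 < deriv g t) ∧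
      StrictMono g := by
  obtain ⟨g, hmem, h0, htop, hbot, hd⟩ := hW.exists_profile
  have hpos : ∀ t, 0 < deriv g t := fun t => by
    rw [(hd t).deriv]; exact hW.sqrt_two_mul_pos (hmem t)
  refine ⟨g, ⟨hW.contDiff_two hmem hd, fun t => ?_, hmem, h0, htop, hbot⟩, ?_,
    fun t => ⟨(hd t).deriv, hpos t⟩, strictMono_of_deriv_pos hpos⟩
  · rw [show deriv g = fun t => Real.sqrt (2 * W (g t)) from funext fun t => (hd t).deriv]
    exact (hW.hasDerivAt_sqrt_comp (hmem t) (hd t)).deriv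
  · rintro h ⟨hC, hode, hhmem, hh0, hhtop, hhbot⟩
    have hhd := hW.hasDerivAt_of_heteroclinic hC hode hhmem hhtop hhbot
    funext t
    exact Real.artanh_injOn (hhmem t) (hmem t) (hW.travelTime_strictMono.injective
      ((travelTime_artanh_eq hW hhmem hh0 hhd t).trans
        (travelTime_artanh_eq hW hmem h0 hd t).symm))
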